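/- Let X be a non-compact Polish space and let F ⊆ X be an infinite discrete closed subset (hence F is countable). Then for every countable ordinal α there exists a presentation P_α = (X, d_α, x̄_α) of X such that φ_{P_α}(F) ≥ α. -/

import Mathlib

open Set Filter Topology

/-- A presentation `(X, d, x̄)` of a Polish space `X`: a complete metric `d`
compatible with the topology of `X`, together with a dense sequence `x̄`. -/
structure Presentation (X : Type) [TopologicalSpace X] where
  dist : X → X → ℝ
  seq : ℕ → X
  dist_self : ∀ x, dist x x = 0
  eq_of_dist_eq_zero : ∀ x y, dist x y = 0 → x = y
  dist_comm : ∀ x y, dist x y = dist y x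
  dist_triangle : ∀ x y z, dist x z ≤ dist x y + dist y z
  /-- `d` is compatible with the topology of `X`. -/
  isOpen_iff : ∀ s : Set X, IsOpen s ↔ ∀ x ∈ s, ∃ ε > 0, ∀ y, dist y x < ε → y ∈ s
  /-- `d` is complete. -/
  complete : ∀ u : ℕ → X, (∀ ε > 0, ∃ N, ∀ m ≥ N, ∀ n ≥ N, dist (u m) (u n) < ε) →
      ∃ x, ∀ ε > 0, ∃ N, ∀ n ≥ N, dist (u n) x < ε
  /-- the sequence `x̄` is dense. -/
  dense : ∀ x, ∀ ε > 0, ∃ i, dist x (seq i) < ε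

namespace Presentation

variable {X : Type} [TopologicalSpace X] (P : Presentation X)

/-- The open ball `B_P(n)`. -/
def ball (n : ℕ × ℕ) : Set X := {x | P.dist x (P.seq n.1) < (1/2 : ℝ) ^ (n.2 + 1)}

/-- The closed ball `B̄_P(n)`. -/
def cball (n : ℕ × ℕ) : Set X := {x | P.dist x (P.seq n.1) ≤ (1/2 : ℝ) ^ (n.2 + 1)}

/-- The relation `n ≺_P m`. -/
def prec (n m : ℕ × ℕ) : Prop := n.2 < m.2 ∧ P.cball m ⊆ P.ball n

/-- The relation `n ⋏_P m`. -/
def apart (n m : ℕ × ℕ) : Prop := P.cball n ∩ P.cball m = ∅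

/-- The code `A_F^P` of a closed set `F ⊆ X`. -/
def code (F : Set X) : Set (ℕ × ℕ) := {n | (P.ball n ∩ F).Nonempty}

/-- The derivative `D_P` on subsets of `ω × ω`. -/
def deriv (A : Set (ℕ × ℕ)) : Set (ℕ × ℕ) :=
  {n ∈ A | ∃ u ∈ A, ∃ v ∈ A, P.prec n u ∧ P.prec n v ∧ P.apart u v}

/-- The transfinite iterates `D_P^α(A)`. -/
noncomputable def derivIter (A : Set (ℕ × ℕ)) (α : Ordinal.{0}) : Set (ℕ × ℕ) :=
  Ordinal.limitRecOn α A (fun _ ih => P.deriv ih)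
    (fun o _ ih => ⋂ (β : {β : Ordinal.{0} // β < o}), ih β.1 β.2)

/-- The rank `|A|_P`: the least ordinal `α` with `D_P^α(A) = D_P^{α+1}(A)`. -/
noncomputable def rankA (A : Set (ℕ × ℕ)) : Ordinal.{0} :=
  sInf {α | P.derivIter A (α + 1) = P.derivIter A α}

/-- The rank `φ_P(F) = |A_F^P|_P` of a (countable closed) subset `F ⊆ X`. -/
noncomputable def phi (F : Set X) : Ordinal.{0} := P.rankA (P.code F)

/-- `A ⊆ ω × ω` is `P`-closed. -/
def PClosed (A : Set (ℕ × ℕ)) : Prop := ∀ n ∈ A, ∀ m, P.prec m n → m ∈ A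

/-- `A ⊆ ω × ω` is `P`-pruned. -/
def PPruned (A : Set (ℕ × ℕ)) : Prop := ∀ n ∈ A, ∃ m ∈ A, P.prec n m

/-- `A ⊆ ω × ω` is `P`-perfect. -/
def PPerfect (A : Set (ℕ × ℕ)) : Prop :=
  ∀ n ∈ A, ∃ u ∈ A, ∃ v ∈ A, P.prec n u ∧ P.prec n v ∧ P.apart u v

/-- The set `[A]_P` of `P`-compatible sequences lying in `A`. -/
def body (A : Set (ℕ × ℕ)) : Set (ℕ → ℕ × ℕ) :=
  {f | (∀ i, P.prec (f i) (f (i + 1))) ∧ ∀ i, f i ∈ A}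

/-- The set `F_A^P = π_P([A]_P)`: the points obtained as the unique point of
`⋂_i B_P(n_i)` for a `P`-compatible sequence `(n_i)` in `A`. -/
def limitSet (A : Set (ℕ × ℕ)) : Set X :=
  {x | ∃ f ∈ P.body A, ∀ i, x ∈ P.ball (f i)}

end Presentation

section CB

variable {X : Type} [TopologicalSpace X]

/-- The Cantor–Bendixson derivative: the set of limit points of `F` in `F`. -/
def cbDeriv (F : Set X) : Set X := {x ∈ F | AccPt x (𝓟 F)}

/-- The iterated Cantor–Bendixson derivatives `F^α`. -/
noncomputable def cbIter (F : Set X) (α : Ordinal.{0}) : Set X :=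
  Ordinal.limitRecOn α F (fun _ ih => cbDeriv ih)
    (fun o _ ih => ⋂ (β : {β : Ordinal.{0} // β < o}), ih β.1 β.2)

/-- The Cantor–Bendixson rank `|F|_CB`. -/
noncomputable def cbRank (F : Set X) : Ordinal.{0} :=
  sInf {α | cbIter F (α + 1) = cbIter F α}

/-- The `K_σ`-derivative of a subset `A ⊆ X`: the points of `A` having no open
neighborhood in the subspace `A` whose closure in `A` is compact. -/
def kDeriv (A : Set X) : Set X :=
  {x ∈ A | ∀ U : Set X, IsOpen U → x ∈ U → ¬ IsCompact (A ∩ closure (U ∩ A))}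

/-- The iterated `K_σ`-derivatives `X_α` of the space `X`. -/
noncomputable def kIter (X : Type) [TopologicalSpace X] (α : Ordinal.{0}) : Set X :=
  Ordinal.limitRecOn α Set.univ (fun _ ih => kDeriv ih)
    (fun o _ ih => ⋂ (β : {β : Ordinal.{0} // β < o}), ih β.1 β.2)

/-- The `K_σ`-rank `|X|_{K_σ}`. -/
noncomputable def kRank (X : Type) [TopologicalSpace X] : Ordinal.{0} :=
  sInf {α | kIter X (α + 1) = kIter X α}

end CB

section Shortcut

variable {X ι : Type*} [MetricSpace X] [MetricSpace ι]

/-- The distance on `X` obtained from the given one by allowing a shortcut through the points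
`e i`, where travelling from `e i` to `e j` costs `dist i j`. -/
noncomputable def shortcutDist (e : ι → X) (x y : X) : ℝ :=
  min (dist x y) (⨅ p : ι × ι, dist x (e p.1) + dist p.1 p.2 + dist (e p.2) y)

theorem shortcutDist_lt_iff [Nonempty ι] {e : ι → X} {x y : X} {ε : ℝ} :
    shortcutDist e x y < ε ↔
      dist x y < ε ∨ ∃ a b, dist x (e a) + dist a b + dist (e b) y < ε := by
  have hb : BddBelow (range fun p : ι × ι => dist x (e p.1) + dist p.1 p.2 + dist (e p.2) y) :=
    ⟨0, by rintro _ ⟨p, rfl⟩; positivity⟩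
  rw [shortcutDist, min_lt_iff, ciInf_lt_iff hb, Prod.exists]

theorem shortcutDist_le (e : ι → X) (x y : X) : shortcutDist e x y ≤ dist x y :=
  min_le_left _ _

theorem shortcutDist_nonneg (e : ι → X) (x y : X) : 0 ≤ shortcutDist e x y :=
  le_min dist_nonneg (Real.iInf_nonneg fun _ => by positivity)

theorem shortcutDist_self (e : ι → X) (x : X) : shortcutDist e x x = 0 :=
  le_antisymm ((shortcutDist_le e x x).trans_eq (dist_self x)) (shortcutDist_nonneg e x x)

variable [Nonempty ι] {e : ι → X}

theorem shortcutDist_comm (x y : X) : shortcutDist e x y = shortcutDist e y x := by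
  have key : ∀ x y : X, shortcutDist e x y ≤ shortcutDist e y x := fun x y => by
    refine le_of_forall_gt fun ε hε => ?_
    rw [shortcutDist_lt_iff] at hε ⊢
    rcases hε with h | ⟨a, b, h⟩
    · exact Or.inl (by rwa [dist_comm])
    · refine Or.inr ⟨b, a, ?_⟩
      rw [dist_comm x, dist_comm b, dist_comm _ y]
      linarith
  exact le_antisymm (key x y) (key y x)

theorem shortcutDist_triangle (he : ∀ i j, dist i j ≤ dist (e i) (e j)) (x y z : X) :
    shortcutDist e x z ≤ shortcutDist e x y + shortcutDist e y z := by
  refine le_of_forall_pos_lt_add fun δ hδ => ?_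
  have h₁ : shortcutDist e x y < shortcutDist e x y + δ / 2 := by linarith
  have h₂ : shortcutDist e y z < shortcutDist e y z + δ / 2 := by linarith
  rw [shortcutDist_lt_iff] at h₁ h₂ ⊢
  rcases h₁ with h₁ | ⟨a, b, h₁⟩ <;> rcases h₂ with h₂ | ⟨c, d, h₂⟩
  · exact Or.inl (by linarith [dist_triangle x y z])
  · exact Or.inr ⟨c, d, by linarith [dist_triangle x y (e c)]⟩
  · exact Or.inr ⟨a, b, by linarith [dist_triangle (e b) y z]⟩
  · exact Or.inr ⟨a, d, by
      linarith [dist_triangle4 a b c d, he b c, dist_triangle (e b) y (e c)]⟩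

theorem shortcutDist_apply (he : ∀ i j, dist i j ≤ dist (e i) (e j)) (i j : ι) :
    shortcutDist e (e i) (e j) = dist i j := by
  refine le_antisymm ?_ (le_of_forall_gt fun ε hε => ?_)
  · refine le_of_forall_gt fun ε hε => shortcutDist_lt_iff.2 (Or.inr ⟨i, j, ?_⟩)
    simpa using hε
  · rcases shortcutDist_lt_iff.1 hε with h | ⟨a, b, h⟩
    · exact (he i j).trans_lt h
    · linarith [dist_triangle4 i a b j, he i a, he b j]

theorem exists_forall_dist_lt_of_shortcutDist_lt [DiscreteTopology ι]
    (hsep : ∀ i j, i ≠ j → 1 ≤ dist (e i) (e j)) (x : X) {ε : ℝ} (hε : 0 < ε) :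
    ∃ δ > 0, ∀ y, shortcutDist e y x < δ → dist y x < ε := by
  by_cases hx : ∃ i, e i = x
  · obtain ⟨i, rfl⟩ := hx
    obtain ⟨η, hη, h⟩ := Metric.isOpen_singleton_iff.1 (isOpen_discrete {i})
    refine ⟨min ε (min 1 η), by positivity, fun y hy => ?_⟩
    rw [shortcutDist_lt_iff] at hy
    simp only [lt_min_iff] at hy
    rcases hy with hy | ⟨a, b, hy, hy1, hyη⟩
    · exact hy.1
    · have hb : b = i := by
        by_contra hb
        linarith [hsep b i hb, dist_nonneg (x := y) (y := e a), dist_nonneg (x := a) (y := b)]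
      subst hb
      have ha : a = b := h a (by
        linarith [dist_nonneg (x := y) (y := e a), dist_self (e b)])
      subst ha
      linarith [dist_self (e a), dist_self a]
  · push Not at hx
    obtain ⟨η, hη, h⟩ : ∃ η > 0, ∀ i, η ≤ dist (e i) x := by
      by_cases hi : ∃ i, dist (e i) x < 1 / 2
      · obtain ⟨i, hi⟩ := hi
        refine ⟨dist (e i) x, dist_pos.2 (hx i), fun j => ?_⟩
        by_cases hij : i = j
        · rw [hij]
        · linarith [hsep i j hij, dist_triangle_right (e i) (e j) x]
      · push Not at hi
        exact ⟨1 / 2, by norm_num, hi⟩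
    refine ⟨min ε η, by positivity, fun y hy => ?_⟩
    rw [shortcutDist_lt_iff] at hy
    simp only [lt_min_iff] at hy
    rcases hy with hy | ⟨a, b, -, hy⟩
    · exact hy.1
    · linarith [h b, dist_nonneg (x := y) (y := e a), dist_nonneg (x := a) (y := b)]

theorem exists_limit_of_shortcutDist_cauchy [CompleteSpace X] [CompleteSpace ι]
    (he : ∀ i j, dist i j ≤ dist (e i) (e j)) (u : ℕ → X)
    (hu : ∀ ε > 0, ∃ N, ∀ m ≥ N, ∀ n ≥ N, shortcutDist e (u m) (u n) < ε) :
    ∃ x, ∀ ε > 0, ∃ N, ∀ n ≥ N, shortcutDist e (u n) x < ε := by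
  by_cases hfar : ∃ η > 0, ∃ N, ∀ n ≥ N, ∀ i, η ≤ dist (u n) (e i)
  · obtain ⟨η, hη, N, hN⟩ := hfar
    have hc : CauchySeq u := by
      refine Metric.cauchySeq_iff.2 fun ε hε => ?_
      obtain ⟨M, hM⟩ := hu (min ε η) (by positivity)
      refine ⟨max M N, fun m hm n hn => ?_⟩
      have h := hM m (le_of_max_le_left hm) n (le_of_max_le_left hn)
      rw [shortcutDist_lt_iff] at h
      simp only [lt_min_iff] at h
      rcases h with h | ⟨a, b, -, h⟩
      · exact h.1
      · linarith [hN m (le_of_max_le_right hm) a, dist_nonneg (x := e b) (y := u n),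
          dist_nonneg (x := a) (y := b)]
    obtain ⟨x, hx⟩ := cauchySeq_tendsto_of_complete hc
    refine ⟨x, fun ε hε => ?_⟩
    obtain ⟨M, hM⟩ := Metric.tendsto_atTop.1 hx ε hε
    exact ⟨M, fun n hn => (shortcutDist_le e _ _).trans_lt (hM n hn)⟩
  · push Not at hfar
    have hnear : ∀ k : ℕ, ∃ n ≥ k, ∃ i, dist (u n) (e i) < 1 / ((k : ℝ) + 1) := fun k =>
      hfar _ Nat.one_div_pos_of_nat k
    choose n hn i hi using hnear
    have hsmall : ∀ ε > (0 : ℝ), ∃ K : ℕ, ∀ k ≥ K, dist (u (n k)) (e (i k)) < ε := fun ε hε => by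
      obtain ⟨K, hK⟩ := exists_nat_one_div_lt hε
      exact ⟨K, fun k hk => (hi k).trans ((Nat.one_div_le_one_div hk).trans_lt hK)⟩
    have hc : CauchySeq i := by
      refine Metric.cauchySeq_iff.2 fun ε hε => ?_
      obtain ⟨K, hK⟩ := hsmall (ε / 3) (by positivity)
      obtain ⟨N, hN⟩ := hu (ε / 3) (by positivity)
      refine ⟨max K N, fun k hk l hl => ?_⟩
      have hk' := hK k (le_of_max_le_left hk)
      have hl' := hK l (le_of_max_le_left hl)
      have hkl := hN (n k) ((le_of_max_le_right hk).trans (hn k))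
        (n l) ((le_of_max_le_right hl).trans (hn l))
      rw [← shortcutDist_apply he]
      have h₁ := shortcutDist_triangle he (e (i k)) (u (n k)) (e (i l))
      have h₂ := shortcutDist_triangle he (u (n k)) (u (n l)) (e (i l))
      have h₃ := shortcutDist_le e (e (i k)) (u (n k))
      have h₄ := shortcutDist_le e (u (n l)) (e (i l))
      rw [dist_comm] at h₃
      linarith
    obtain ⟨j, hj⟩ := cauchySeq_tendsto_of_complete hc
    refine ⟨e j, fun ε hε => ?_⟩
    obtain ⟨K, hK⟩ := hsmall (ε / 3) (by positivity)
    obtain ⟨N, hN⟩ := hu (ε / 3) (by positivity)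
    obtain ⟨M, hM⟩ := Metric.tendsto_atTop.1 hj (ε / 3) (by positivity)
    refine ⟨N, fun m hm => ?_⟩
    set k := max (max K M) N
    have hk : dist (u (n k)) (e (i k)) < ε / 3 := hK k (by omega)
    have hk' : shortcutDist e (e (i k)) (e j) < ε / 3 := by
      rw [shortcutDist_apply he]
      exact hM k (by omega)
    have hmk := hN m hm (n k) ((show N ≤ k by omega).trans (hn k))
    have h₁ := shortcutDist_triangle he (u m) (u (n k)) (e j)
    have h₂ := shortcutDist_triangle he (u (n k)) (e (i k)) (e j)
    have h₃ := shortcutDist_le e (u (n k)) (e (i k))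
    linarith

end Shortcut

/-- A complete discrete metric space of diameter at most `1` can be realised isometrically on any
`1`-separated family in a complete separable metric space, after changing the metric. -/
theorem exists_presentation_dist_apply_eq {X : Type} {ι : Type*} [MetricSpace X] [CompleteSpace X]
    [TopologicalSpace.SeparableSpace X] [MetricSpace ι] [CompleteSpace ι] [DiscreteTopology ι]
    [Nonempty ι] [Countable ι] (hι : ∀ i j : ι, dist i j ≤ 1) (e : ι → X)
    (hsep : ∀ i j, i ≠ j → 1 ≤ dist (e i) (e j)) :
    ∃ P : Presentation X, (∀ i j, P.dist (e i) (e j) = dist i j) ∧ ∀ i, ∃ n, P.seq n = e i := by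
  have he : ∀ i j, dist i j ≤ dist (e i) (e j) := fun i j => by
    by_cases h : i = j
    · simp [h]
    · exact (hι i j).trans (hsep i j h)
  obtain ⟨D, hDc, hD⟩ := TopologicalSpace.exists_countable_dense X
  obtain ⟨s, hs⟩ := (hDc.union (countable_range e)).exists_eq_range
    ((range_nonempty e).mono subset_union_right)
  refine ⟨{
    dist := shortcutDist e
    seq := s
    dist_self := shortcutDist_self e
    eq_of_dist_eq_zero := fun x y h => ?_
    dist_comm := shortcutDist_comm
    dist_triangle := shortcutDist_triangle he
    isOpen_iff := fun U => ?_
    complete := exists_limit_of_shortcutDist_cauchy he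
    dense := fun x ε hε => ?_ }, shortcutDist_apply he, fun i => ?_⟩
  · refine dist_le_zero.1 (le_of_forall_pos_lt_add fun ε hε => ?_)
    obtain ⟨δ, hδ, hδε⟩ := exists_forall_dist_lt_of_shortcutDist_lt hsep y hε
    simpa using hδε x (h.trans_lt hδ)
  · rw [Metric.isOpen_iff]
    refine forall₂_congr fun x _ => ⟨fun ⟨ε, hε, h⟩ => ?_, fun ⟨ε, hε, h⟩ => ?_⟩
    · obtain ⟨δ, hδ, hδε⟩ := exists_forall_dist_lt_of_shortcutDist_lt hsep x hε
      exact ⟨δ, hδ, fun y hy => h (hδε y hy)⟩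
    · exact ⟨ε, hε, fun y hy => h y ((shortcutDist_le e y x).trans_lt hy)⟩
  · obtain ⟨y, hy, hxy⟩ := hD.exists_dist_lt x hε
    obtain ⟨n, rfl⟩ : y ∈ range s := hs ▸ Or.inl hy
    exact ⟨n, (shortcutDist_le e _ _).trans_lt hxy⟩
  · have : e i ∈ range s := hs ▸ Or.inr ⟨i, rfl⟩
    exact this

namespace Presentation

variable {X : Type} [TopologicalSpace X] (P : Presentation X)

theorem ball_subset_cball (n : ℕ × ℕ) : P.ball n ⊆ P.cball n := fun x hx =>
  le_of_lt (show P.dist x (P.seq n.1) < (1 / 2 : ℝ) ^ (n.2 + 1) from hx)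

theorem derivIter_zero (A : Set (ℕ × ℕ)) : P.derivIter A 0 = A :=
  Ordinal.limitRecOn_zero _ _ _

theorem derivIter_add_one (A : Set (ℕ × ℕ)) (β : Ordinal.{0}) :
    P.derivIter A (β + 1) = P.deriv (P.derivIter A β) :=
  Ordinal.limitRecOn_add_one _ _ _ _

theorem derivIter_limit (A : Set (ℕ × ℕ)) {β : Ordinal.{0}} (hβ : Order.IsSuccLimit β) :
    P.derivIter A β = ⋂ γ : {γ : Ordinal.{0} // γ < β}, P.derivIter A γ :=
  Ordinal.limitRecOn_limit _ _ _ _ hβ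

theorem derivIter_anti (A : Set (ℕ × ℕ)) {β γ : Ordinal.{0}} (h : γ ≤ β) :
    P.derivIter A β ⊆ P.derivIter A γ := by
  induction β using Ordinal.limitRecOn with
  | zero => rw [nonpos_iff_eq_zero.1 h]
  | add_one β ih =>
    rcases h.eq_or_lt with rfl | h
    · exact subset_rfl
    · rw [derivIter_add_one]
      exact fun n hn => ih (Order.lt_add_one_iff.1 h) hn.1
  | limit β hβ ih =>
    rcases h.eq_or_lt with rfl | h
    · exact subset_rfl
    · rw [derivIter_limit P A hβ]
      exact fun n hn => mem_iInter.1 hn ⟨γ, h⟩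

theorem derivIter_subset (A : Set (ℕ × ℕ)) (β : Ordinal.{0}) : P.derivIter A β ⊆ A :=
  (P.derivIter_anti A zero_le).trans_eq (P.derivIter_zero A)

theorem exists_derivIter_add_one_eq (A : Set (ℕ × ℕ)) :
    ∃ β, P.derivIter A (β + 1) = P.derivIter A β := by
  by_contra! h
  have hlt : ∀ β γ, β < γ → P.derivIter A β ≠ P.derivIter A γ := fun β γ hβγ heq =>
    h β ((P.derivIter_anti A (lt_add_one β).le).antisymm
      (heq.trans_subset (P.derivIter_anti A (Order.add_one_le_of_lt hβγ))))
  refine not_injective_of_ordinal (P.derivIter A) fun β γ heq => ?_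
  by_contra hne
  rcases lt_or_gt_of_ne hne with hβγ | hβγ
  · exact hlt _ _ hβγ heq
  · exact hlt _ _ hβγ heq.symm

/-- A `P`-perfect set of codes of balls meeting `F` produces an accumulation point of `F`. -/
theorem PPerfect.exists_accPt {P : Presentation X} {A : Set (ℕ × ℕ)} (hA : P.PPerfect A)
    (hne : A.Nonempty) {F : Set X} (hAF : A ⊆ P.code F) : ∃ x, AccPt x (𝓟 F) := by
  by_contra! hacc
  obtain ⟨n₀, hn₀⟩ := hne
  have hnext : ∀ n : A, ∃ m : A, P.prec n m := fun n => by
    obtain ⟨u, hu, -, -, h, -⟩ := hA n n.2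
    exact ⟨⟨u, hu⟩, h⟩
  choose next hprec using hnext
  let b : ℕ → A := fun k => next^[k] ⟨n₀, hn₀⟩
  have hb : ∀ k, P.prec (b k) (b (k + 1)) := fun k => by
    simp only [b, Function.iterate_succ_apply']
    exact hprec _
  have hmono : ∀ k l, k ≤ l → P.ball (b l) ⊆ P.ball (b k) := fun k l hkl => by
    induction l, hkl using Nat.le_induction with
    | base => exact subset_rfl
    | succ l _ ih => exact fun x hx => ih ((hb l).2 (P.ball_subset_cball _ hx))
  have hlevel : ∀ k, k ≤ (b k).1.2 := fun k => by
    induction k with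
    | zero => exact Nat.zero_le _
    | succ k ih => exact ih.trans_lt (hb k).1
  have hdiam : ∀ k, ∀ x ∈ P.ball (b k), ∀ y ∈ P.ball (b k), P.dist x y < (1 / 2 : ℝ) ^ k := by
    intro k x hx y hy
    have hx' : P.dist x _ < _ := hx
    have hy' : P.dist y _ < _ := hy
    have h := P.dist_triangle x (P.seq (b k).1.1) y
    rw [P.dist_comm (P.seq _) y] at h
    have hpow : (1 / 2 : ℝ) ^ (b k).1.2 ≤ (1 / 2 : ℝ) ^ k :=
      pow_le_pow_of_le_one (by norm_num) (by norm_num) (hlevel k)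
    rw [pow_succ] at hx' hy'
    linarith
  choose p hpb _ using fun k => hAF (b k).2
  obtain ⟨x, hx⟩ := P.complete p fun ε hε => by
    obtain ⟨N, hN⟩ := exists_pow_lt_of_lt_one hε (by norm_num : (1 / 2 : ℝ) < 1)
    exact ⟨N, fun m hm n hn =>
      (hdiam N _ (hmono N m hm (hpb m)) _ (hmono N n hn (hpb n))).trans hN⟩
  obtain ⟨ε, hε, hiso⟩ : ∃ ε > 0, ∀ y ∈ F, P.dist y x < ε → y = x := by
    have h := hacc x
    rw [accPt_iff_nhds] at h
    push Not at h
    obtain ⟨U, hU, hUF⟩ := h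
    obtain ⟨V, hVU, hV, hxV⟩ := mem_nhds_iff.1 hU
    obtain ⟨ε, hε, h⟩ := (P.isOpen_iff V).1 hV x hxV
    exact ⟨ε, hε, fun y hy hyx => hUF y ⟨hVU (h y hyx), hy⟩⟩
  obtain ⟨k, hk⟩ := exists_pow_lt_of_lt_one (half_pos hε) (by norm_num : (1 / 2 : ℝ) < 1)
  obtain ⟨N, hN⟩ := hx (ε / 2) (half_pos hε)
  have hball : ∀ y ∈ P.ball (b k), y ∈ F → y = x := fun y hy hyF => by
    refine hiso y hyF ?_
    have h₁ := hdiam k y hy _ (hmono k _ (le_max_left k N) (hpb _))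
    have h₂ := hN _ (le_max_right k N)
    linarith [P.dist_triangle y (p (max k N)) x]
  obtain ⟨u, hu, v, hv, hku, hkv, huv⟩ := hA (b k) (b k).2
  obtain ⟨y, hyu, hyF⟩ := hAF hu
  obtain ⟨z, hzv, hzF⟩ := hAF hv
  have hy : y = x := hball y (hku.2 (P.ball_subset_cball u hyu)) hyF
  have hz : z = x := hball z (hkv.2 (P.ball_subset_cball v hzv)) hzF
  have hmem : x ∈ P.cball u ∩ P.cball v :=
    ⟨hy ▸ P.ball_subset_cball u hyu, hz ▸ P.ball_subset_cball v hzv⟩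
  rw [huv] at hmem
  exact hmem

theorem le_phi {F : Set X} (hF : ∀ x, ¬ AccPt x (𝓟 F)) {α : Ordinal.{0}}
    (h : ∀ β < α, (P.derivIter (P.code F) β).Nonempty) : α ≤ P.phi F := by
  have hlt : ∀ β < α, P.derivIter (P.code F) (β + 1) ≠ P.derivIter (P.code F) β := by
    intro β hβ heq
    rw [derivIter_add_one] at heq
    have hperf : P.PPerfect (P.derivIter (P.code F) β) := fun n hn => by
      rw [← heq] at hn
      exact hn.2
    obtain ⟨x, hx⟩ := hperf.exists_accPt (h β hβ) (P.derivIter_subset _ β)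
    exact hF x hx
  exact le_csInf (P.exists_derivIter_add_one_eq _) fun β hβ =>
    not_lt.1 fun hlt' => hlt β hlt' hβ

end Presentation

/-- Finite sequences of bits labelled by strictly decreasing ordinals below `α`. -/
def DescSeq (α : Ordinal.{0}) : Type 1 :=
  {l : List (Iio α × Bool) // l.Pairwise fun a b => b.1 < a.1}

namespace DescSeq

variable {α : Ordinal.{0}}

/-- The `k`-th entry of a sequence, if there is one. -/
def entry (s : DescSeq α) (k : ℕ) : Option (Iio α × Bool) := s.1[k]?

theorem entry_injective : Function.Injective (entry (α := α)) := fun _ _ h =>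
  Subtype.ext (List.ext_getElem? (congr_fun h))

instance : Nonempty (DescSeq α) := ⟨⟨[], List.Pairwise.nil⟩⟩

theorem countable (hα : α.card ≤ Cardinal.aleph0) : Countable (DescSeq α) := by
  have : Countable (Iio α) := by
    rw [← Cardinal.mk_le_aleph0_iff, Cardinal.mk_Iio_ordinal]
    exact Cardinal.lift_le_aleph0.2 hα
  exact Subtype.countable

open Classical in
noncomputable instance : Dist (DescSeq α) where
  dist s t := if s = t then 0 else (1 / 2 : ℝ) ^ (3 * PiNat.firstDiff s.entry t.entry + 2)

theorem dist_of_ne {s t : DescSeq α} (h : s ≠ t) :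
    dist s t = (1 / 2 : ℝ) ^ (3 * PiNat.firstDiff s.entry t.entry + 2) := if_neg h

theorem dist_self_eq (s : DescSeq α) : dist s s = 0 := if_pos rfl

theorem dist_le_max (s t r : DescSeq α) : dist s r ≤ max (dist s t) (dist t r) := by
  by_cases hst : s = t
  · subst hst; exact le_max_right _ _
  by_cases htr : t = r
  · subst htr; exact le_max_left _ _
  by_cases hsr : s = r
  · subst hsr
    rw [dist_self_eq, dist_of_ne hst]
    exact le_max_of_le_left (by positivity)
  rw [dist_of_ne hst, dist_of_ne htr, dist_of_ne hsr, le_max_iff]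
  have h := PiNat.min_firstDiff_le s.entry t.entry r.entry (entry_injective.ne hsr)
  rcases min_le_iff.1 h with h | h
  · exact Or.inl (pow_le_pow_of_le_one (by norm_num) (by norm_num) (by omega))
  · exact Or.inr (pow_le_pow_of_le_one (by norm_num) (by norm_num) (by omega))

theorem dist_nonneg' (s t : DescSeq α) : 0 ≤ dist s t := by
  by_cases h : s = t
  · rw [h, dist_self_eq]
  · rw [dist_of_ne h]; positivity

noncomputable instance : MetricSpace (DescSeq α) where
  dist_self := dist_self_eq
  dist_comm s t := by
    by_cases h : s = t
    · rw [h]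
    · rw [dist_of_ne h, dist_of_ne (Ne.symm h), PiNat.firstDiff_comm]
  dist_triangle s t r := (dist_le_max s t r).trans
    (max_le_add_of_nonneg (dist_nonneg' s t) (dist_nonneg' t r))
  eq_of_dist_eq_zero {s t} h := by
    by_contra hst
    rw [dist_of_ne hst] at h
    exact (pow_pos (by norm_num : (0 : ℝ) < 1 / 2) _).ne' h

theorem dist_le_one (s t : DescSeq α) : dist s t ≤ 1 := by
  by_cases h : s = t
  · rw [h, dist_self]; exact zero_le_one
  · rw [dist_of_ne h]
    exact pow_le_one₀ (by norm_num) (by norm_num)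

theorem entry_eq_of_dist_lt {s t : DescSeq α} {k : ℕ} (h : dist s t < (1 / 2 : ℝ) ^ (3 * k + 2))
    {j : ℕ} (hj : j ≤ k) : s.entry j = t.entry j := by
  by_cases hst : s = t
  · rw [hst]
  rw [dist_of_ne hst, pow_lt_pow_iff_right_of_lt_one₀ (by norm_num) (by norm_num)] at h
  exact PiNat.apply_eq_of_lt_firstDiff (by omega)

theorem eq_of_dist_lt {s t : DescSeq α} {k : ℕ} (h : dist s t < (1 / 2 : ℝ) ^ (3 * k + 2))
    (hk : s.entry k = none) : s = t := by
  refine entry_injective (funext fun j => ?_)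
  rcases le_total j k with hj | hj
  · exact entry_eq_of_dist_lt h hj
  · have ht : t.entry k = none := entry_eq_of_dist_lt h le_rfl ▸ hk
    simp only [entry, List.getElem?_eq_none_iff] at hk ht ⊢
    rw [List.getElem?_eq_none (hk.trans hj), List.getElem?_eq_none (ht.trans hj)]

theorem entry_length (s : DescSeq α) : s.entry s.1.length = none :=
  List.getElem?_eq_none le_rfl

instance : DiscreteTopology (DescSeq α) :=
  discreteTopology_iff_isOpen_singleton.2 fun s => Metric.isOpen_singleton_iff.2
    ⟨(1 / 2 : ℝ) ^ (3 * s.1.length + 2), by positivity, fun t ht =>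
      (eq_of_dist_lt (by rwa [dist_comm]) s.entry_length).symm⟩

instance : CompleteSpace (DescSeq α) := by
  refine Metric.complete_of_cauchySeq_tendsto fun u hu => ?_
  rw [Metric.cauchySeq_iff] at hu
  choose N hN using fun k : ℕ => hu ((1 / 2 : ℝ) ^ (3 * k + 2)) (by positivity)
  obtain ⟨k, hk⟩ : ∃ k, (u (N k)).entry k = none := by
    by_contra! hne
    choose x hx using fun k => Option.ne_none_iff_exists'.1 (hne k)
    refine (wellFounded_iff_isEmpty_descending_chain.1 (wellFounded_lt (α := Iio α))).false
      ⟨fun k => (x k).1, fun k => ?_⟩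
    set m := max (N k) (N (k + 1))
    have h₁ : (u m).entry k = some (x k) := by
      rw [entry_eq_of_dist_lt (hN k m (le_max_left _ _) _ le_rfl) le_rfl, hx]
    have h₂ : (u m).entry (k + 1) = some (x (k + 1)) := by
      rw [entry_eq_of_dist_lt (hN (k + 1) m (le_max_right _ _) _ le_rfl) le_rfl, hx]
    obtain ⟨hk₁, h₁⟩ := List.getElem?_eq_some_iff.1 h₁
    obtain ⟨hk₂, h₂⟩ := List.getElem?_eq_some_iff.1 h₂
    change (x (k + 1)).1 < (x k).1
    rw [← h₁, ← h₂]
    exact List.pairwise_iff_getElem.1 (u m).2 k (k + 1) hk₁ hk₂ k.lt_succ_self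
  refine ⟨u (N k), tendsto_const_nhds.congr' ?_⟩
  filter_upwards [eventually_ge_atTop (N k)] with n hn
  exact eq_of_dist_lt (hN k _ le_rfl n hn) hk

/-- Extend a sequence by one entry. -/
def snoc (s : DescSeq α) (a : Iio α × Bool) (h : ∀ x ∈ s.1, a.1 < x.1) : DescSeq α :=
  ⟨s.1 ++ [a], List.pairwise_append.2 ⟨s.2, List.pairwise_singleton _ _, by simpa using h⟩⟩

theorem length_snoc (s : DescSeq α) (a : Iio α × Bool) (h : ∀ x ∈ s.1, a.1 < x.1) :
    (s.snoc a h).1.length = s.1.length + 1 := by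
  simp [snoc]

theorem entry_snoc_length (s : DescSeq α) (a : Iio α × Bool) (h : ∀ x ∈ s.1, a.1 < x.1) :
    (s.snoc a h).entry s.1.length = some a := by
  simp [snoc, entry]

theorem entry_snoc_of_lt (s : DescSeq α) (a : Iio α × Bool) (h : ∀ x ∈ s.1, a.1 < x.1) {j : ℕ}
    (hj : j < s.1.length) : (s.snoc a h).entry j = s.entry j := by
  simp [snoc, entry, List.getElem?_append_left hj]

theorem dist_eq_of_entry {s t : DescSeq α} {k : ℕ} (hlt : ∀ j < k, s.entry j = t.entry j)
    (hk : s.entry k ≠ t.entry k) : dist s t = (1 / 2 : ℝ) ^ (3 * k + 2) := by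
  have hst : s ≠ t := fun h => hk (by rw [h])
  have : PiNat.firstDiff s.entry t.entry = k := by
    refine le_antisymm (not_lt.1 fun h => hk (PiNat.apply_eq_of_lt_firstDiff h))
      (not_lt.1 fun h => ?_)
    exact PiNat.apply_firstDiff_ne (entry_injective.ne hst) (hlt _ h)
  rw [dist_of_ne hst, this]

theorem dist_snoc (s : DescSeq α) (a : Iio α × Bool) (h : ∀ x ∈ s.1, a.1 < x.1) :
    dist (s.snoc a h) s = (1 / 2 : ℝ) ^ (3 * s.1.length + 2) :=
  dist_eq_of_entry (fun _ hj => entry_snoc_of_lt s a h hj) (by simp [entry_snoc_length, entry_length])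

theorem dist_snoc_snoc (s : DescSeq α) {a b : Iio α × Bool} (ha : ∀ x ∈ s.1, a.1 < x.1)
    (hb : ∀ x ∈ s.1, b.1 < x.1) (hab : a ≠ b) :
    dist (s.snoc a ha) (s.snoc b hb) = (1 / 2 : ℝ) ^ (3 * s.1.length + 2) :=
  dist_eq_of_entry (fun j hj => by rw [entry_snoc_of_lt s a ha hj, entry_snoc_of_lt s b hb hj])
    (by simpa [entry_snoc_length] using hab)

end DescSeq

theorem mem_derivIter_code_of_isometry {X : Type} [TopologicalSpace X] {P : Presentation X}
    {α : Ordinal.{0}} {F : Set X} {e : DescSeq α → X} {c : DescSeq α → ℕ}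
    (heF : ∀ s, e s ∈ F) (he : ∀ s t, P.dist (e s) (e t) = dist s t)
    (hc : ∀ s, P.seq (c s) = e s) (β : Ordinal.{0}) (hβ : β ≤ α) (s : DescSeq α)
    (hs : ∀ x ∈ s.1, β ≤ x.1) : (c s, 3 * s.1.length) ∈ P.derivIter (P.code F) β := by
  induction β using Ordinal.limitRecOn generalizing s with
  | zero =>
    rw [Presentation.derivIter_zero]
    refine ⟨e s, ?_, heF s⟩
    simp only [Presentation.ball, mem_ofPred_eq, hc, P.dist_self]
    positivity
  | add_one γ ih =>
    have hγ : γ < γ + 1 := lt_add_one γ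
    have hγα : γ ≤ α := hγ.le.trans hβ
    have hlt : ∀ i, ∀ x ∈ s.1, ((⟨γ, hγ.trans_le hβ⟩, i) : Iio α × Bool).1 < x.1 :=
      fun i x hx => hγ.trans_le (hs x hx)
    let t : Bool → DescSeq α := fun i => s.snoc _ (hlt i)
    have hlen : ∀ i, (t i).1.length = s.1.length + 1 := fun i => s.length_snoc _ (hlt i)
    have hmem : ∀ i, (c (t i), 3 * (t i).1.length) ∈ P.derivIter (P.code F) γ := fun i => by
      refine ih hγα (t i) fun x hx => ?_
      rcases List.mem_append.1 hx with hx | hx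
      · exact hγ.le.trans (hs x hx)
      · rw [List.mem_singleton.1 hx]
    have hpos : (0 : ℝ) < (1 / 2 : ℝ) ^ (3 * s.1.length) := by positivity
    have hprec : ∀ i, P.prec (c s, 3 * s.1.length) (c (t i), 3 * (t i).1.length) := fun i => by
      refine ⟨by simp only [hlen]; omega, fun y hy => ?_⟩
      have hd : P.dist (e (t i)) (e s) = _ := (he _ _).trans (s.dist_snoc _ (hlt i))
      simp only [Presentation.cball, Presentation.ball, mem_ofPred_eq, hc, hlen] at hy ⊢
      have := P.dist_triangle y (e (t i)) (e s)
      rw [mul_add, pow_add, pow_add] at hy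
      rw [pow_add] at hd ⊢
      norm_num at hy hd ⊢
      linarith
    rw [Presentation.derivIter_add_one]
    refine ⟨ih hγα s fun x hx => hγ.le.trans (hs x hx), _, hmem false, _, hmem true,
      hprec false, hprec true, eq_empty_of_forall_notMem fun y hy => ?_⟩
    obtain ⟨hy₁, hy₂⟩ := hy
    have hd : P.dist (e (t false)) (e (t true)) = _ :=
      (he _ _).trans (s.dist_snoc_snoc (hlt false) (hlt true) (by simp))
    simp only [Presentation.cball, mem_ofPred_eq, hc, hlen] at hy₁ hy₂
    have := P.dist_triangle (e (t false)) y (e (t true))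
    rw [P.dist_comm (e _) y] at this
    rw [mul_add, pow_add, pow_add] at hy₁ hy₂
    rw [pow_add] at hd
    norm_num at hy₁ hy₂ hd
    linarith
  | limit β hl ih =>
    rw [Presentation.derivIter_limit _ _ hl, mem_iInter]
    rintro ⟨γ, hγ⟩
    exact ih γ hγ (hγ.le.trans hβ) s fun x hx => hγ.le.trans (hs x hx)

theorem completeSpace_comapMetricSpace {α β : Type*} [TopologicalSpace α] [MetricSpace β]
    [CompleteSpace β] {f : α → β} (hf : Topology.IsClosedEmbedding f) :
    @CompleteSpace α (hf.isEmbedding.comapMetricSpace f).toUniformSpace := by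
  let := hf.isEmbedding.comapMetricSpace f
  have hu : IsUniformInducing f := ⟨rfl⟩
  exact (completeSpace_iff_isComplete_range hu).2 hf.isClosed_range.isComplete

/-- An infinite set without accumulation points in a Polish space contains a sequence whose terms
are at mutual distance at least `1` for a suitable compatible complete metric. -/
theorem exists_complete_metric_separating {X : Type} [t : TopologicalSpace X] [PolishSpace X]
    {F : Set X} (hF : IsClosed F) (hinf : F.Infinite) (hdisc : ∀ x ∈ F, ¬ AccPt x (𝓟 F)) :
    ∃ (m : MetricSpace X) (f : ℕ → X), m.toUniformSpace.toTopologicalSpace = t ∧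
      CompleteSpace X ∧ (∀ n, f n ∈ F) ∧ ∀ i j, i ≠ j → 1 ≤ dist (f i) (f j) := by
  let := TopologicalSpace.upgradeIsCompletelyMetrizable X
  have : DiscreteTopology F := discreteTopology_subtype_iff.2 fun x hx =>
    not_neBot.1 (hdisc x hx)
  let f := hinf.natEmbedding
  obtain ⟨g, hg⟩ := ContinuousMap.exists_restrict_eq (Y := ℝ) hF
    ⟨fun x => ((Function.invFun f x : ℕ) : ℝ), continuous_of_discreteTopology⟩
  have hgf : ∀ n, g (f n) = n := fun n => by
    have h := DFunLike.congr_fun hg (f n)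
    simpa [Function.leftInverse_invFun f.injective n] using h
  have hemb : Topology.IsClosedEmbedding fun x : X => (x, g x) :=
    ⟨⟨Topology.IsInducing.of_comp (by fun_prop) continuous_fst Topology.IsInducing.id,
      fun x y h => congr_arg Prod.fst h⟩, by
      have : range (fun x : X => (x, g x)) = {p | p.2 = g p.1} := by
        ext ⟨x, r⟩
        simp [eq_comm]
      rw [this]
      exact isClosed_eq continuous_snd (by fun_prop)⟩
  refine ⟨hemb.isEmbedding.comapMetricSpace _, fun n => f n, rfl, ?_, fun n => (f n).2,
    fun i j hij => ?_⟩
  · exact completeSpace_comapMetricSpace hemb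
  · refine (Nat.pairwise_one_le_dist hij).trans ?_
    rw [← Nat.dist_cast_real, ← hgf i, ← hgf j]
    exact le_max_right _ _

/-- For a non-compact Polish space `X` and an infinite discrete closed
`F ⊆ X`, for every countable ordinal `α` there is a presentation `P` with `φ_P(F) ≥ α`. -/
theorem stmt1 {X : Type} [TopologicalSpace X] [PolishSpace X]
    (hnc : ¬ CompactSpace X) (F : Set X) (hF : IsClosed F) (hinf : F.Infinite)
    (hdisc : ∀ x ∈ F, ¬ AccPt x (𝓟 F))
    (α : Ordinal.{0}) (hα : α.card ≤ Cardinal.aleph0) :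
    ∃ P : Presentation X, α ≤ P.phi F := by
  obtain ⟨m, f, rfl, hcomplete, hfF, hf⟩ := exists_complete_metric_separating hF hinf hdisc
  have := DescSeq.countable hα
  obtain ⟨k, hk⟩ := exists_injective_nat (DescSeq α)
  obtain ⟨P, hP, hseq⟩ := exists_presentation_dist_apply_eq DescSeq.dist_le_one
    (fun s => f (k s)) fun s t hst => hf _ _ (hk.ne hst)
  choose c hc using hseq
  refine ⟨P, P.le_phi (fun x hx => ?_) fun β hβ => ?_⟩
  · exact hdisc x (hF.closure_eq ▸ mem_closure_iff_clusterPt.2 hx.clusterPt) hx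
  · exact ⟨_, mem_derivIter_code_of_isometry (fun s => hfF (k s)) hP hc β hβ.le
      ⟨[], List.Pairwise.nil⟩ (by simp)⟩
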